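/- Let σ > 0, θ₀ ∈ ℝ and β ≥ 0. In the normal location model, with u(x) = (x−θ₀)/σ², define J_β = ∫_ℝ u(x)² φ_{θ₀,σ}(x)^{1+β} dx and V_β = ∫_ℝ u(x)² φ_{θ₀,σ}(x)^{1+2β} dx − (∫_ℝ u(x) φ_{θ₀,σ}(x)^{1+β} dx)². Then ∫_ℝ u(x) φ_{θ₀,σ}(x)^{1+β} dx = 0, and the asymptotic variance of the minimum density power divergence estimator of the normal mean equals Σ_β(θ₀) = V_β / J_β² = ((1+β)³ / (1+2β)^{3/2}) · σ². -/

import Mathlib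

open MeasureTheory Real

/-- The density of N(θ, σ²) on ℝ. -/
noncomputable def normalPDF (θ σ : ℝ) (x : ℝ) : ℝ :=
  (Real.sqrt (2 * Real.pi) * σ)⁻¹ * Real.exp (-(x - θ) ^ 2 / (2 * σ ^ 2))

theorem normalPDF_rpow (θ : ℝ) {σ : ℝ} (hσ : 0 < σ) (p x : ℝ) :
    normalPDF θ σ x ^ p =
      (√(2 * π) * σ)⁻¹ ^ p * exp (-(p / (2 * σ ^ 2)) * (x - θ) ^ 2) := by
  unfold normalPDF
  rw [mul_rpow (by positivity) (exp_pos _).le, ← exp_mul]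
  congr 2
  ring

theorem integral_sq_mul_exp_neg_mul_sq {b : ℝ} (hb : 0 < b) :
    ∫ x : ℝ, x ^ 2 * exp (-b * x ^ 2) = √π / 2 * b ^ (-(3 / 2) : ℝ) := by
  have hIoi : ∫ x in Set.Ioi (0 : ℝ), x ^ 2 * exp (-b * x ^ 2) =
      √π / 4 * b ^ (-(3 / 2) : ℝ) := by
    have h := integral_rpow_mul_exp_neg_mul_rpow (p := 2) (q := 2) two_pos (by norm_num) hb
    have hΓ : Gamma ((2 + 1) / 2) = √π / 2 := by
      rw [show ((2 : ℝ) + 1) / 2 = 1 / 2 + 1 by norm_num, Gamma_add_one (by norm_num),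
        Gamma_one_half_eq]
      ring
    rw [hΓ] at h
    simp only [rpow_two] at h
    rw [h, show -((2 : ℝ) + 1) / 2 = -(3 / 2) by norm_num]
    ring
  have h := integral_comp_abs (f := fun x : ℝ => x ^ 2 * exp (-b * x ^ 2))
  simp only [sq_abs] at h
  rw [h, hIoi]
  ring

theorem integral_score_mul_normalPDF_rpow (θ : ℝ) {σ : ℝ} (hσ : 0 < σ) (p : ℝ) :
    ∫ x : ℝ, ((x - θ) / σ ^ 2) * normalPDF θ σ x ^ p = 0 := by
  simp only [normalPDF_rpow θ hσ]
  rw [integral_sub_right_eq_self (fun x : ℝ => x / σ ^ 2 *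
    ((√(2 * π) * σ)⁻¹ ^ p * exp (-(p / (2 * σ ^ 2)) * x ^ 2))) θ]
  rw [← self_eq_neg, ← integral_neg, ← integral_neg_eq_self]
  congr 1 with x
  rw [neg_sq]
  ring

theorem integral_score_sq_mul_normalPDF_rpow (θ : ℝ) {σ p : ℝ} (hσ : 0 < σ) (hp : 0 < p) :
    ∫ x : ℝ, ((x - θ) / σ ^ 2) ^ 2 * normalPDF θ σ x ^ p =
      (√(2 * π) * σ)⁻¹ ^ p * (√2 * √π) * (σ * p ^ (3 / 2 : ℝ))⁻¹ := by
  simp only [normalPDF_rpow θ hσ]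
  rw [integral_sub_right_eq_self (fun x : ℝ => (x / σ ^ 2) ^ 2 *
    ((√(2 * π) * σ)⁻¹ ^ p * exp (-(p / (2 * σ ^ 2)) * x ^ 2))) θ]
  have h : ∀ x : ℝ, (x / σ ^ 2) ^ 2 *
      ((√(2 * π) * σ)⁻¹ ^ p * exp (-(p / (2 * σ ^ 2)) * x ^ 2)) =
      ((√(2 * π) * σ)⁻¹ ^ p / σ ^ 4) * (x ^ 2 * exp (-(p / (2 * σ ^ 2)) * x ^ 2)) :=
    fun x => by ring
  simp only [h]
  rw [integral_const_mul, integral_sq_mul_exp_neg_mul_sq (by positivity)]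
  have h2 : (2 * σ ^ 2) ^ (3 / 2 : ℝ) = 2 * √2 * σ ^ 3 := by
    rw [show (2 : ℝ) * σ ^ 2 = (√2 * σ) ^ 2 by rw [mul_pow, sq_sqrt two_pos.le],
      ← rpow_natCast, ← rpow_mul (by positivity),
      show ((2 : ℕ) : ℝ) * (3 / 2) = (3 : ℕ) by norm_num, rpow_natCast, mul_pow, pow_succ,
      sq_sqrt two_pos.le]
  rw [rpow_neg (by positivity), div_rpow hp.le (by positivity), h2]
  field_simp

/-- In the normal location model, ∫ u φ^{1+β} = 0 and the asymptotic variance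
of the minimum density power divergence estimator of the mean equals
V_β/J_β² = ((1+β)³/(1+2β)^{3/2}) σ². -/
theorem MDPDE_asymptotic_variance_normal (σ θ₀ β : ℝ) (hσ : 0 < σ) (hβ : 0 ≤ β) :
    (∫ x : ℝ, ((x - θ₀) / σ ^ 2) * (normalPDF θ₀ σ x) ^ (1 + β)) = 0 ∧
    ((∫ x : ℝ, ((x - θ₀) / σ ^ 2) ^ 2 * (normalPDF θ₀ σ x) ^ (1 + 2 * β))
        - (∫ x : ℝ, ((x - θ₀) / σ ^ 2) * (normalPDF θ₀ σ x) ^ (1 + β)) ^ 2)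
      / (∫ x : ℝ, ((x - θ₀) / σ ^ 2) ^ 2 * (normalPDF θ₀ σ x) ^ (1 + β)) ^ 2
    = ((1 + β) ^ 3 / (1 + 2 * β) ^ ((3 : ℝ) / 2)) * σ ^ 2 := by
  have hint := integral_score_mul_normalPDF_rpow θ₀ hσ (1 + β)
  refine ⟨hint, ?_⟩
  have hβ₁ : 0 < 1 + β := by linarith
  have hβ₂ : 0 < 1 + 2 * β := by linarith
  rw [hint, integral_score_sq_mul_normalPDF_rpow θ₀ hσ hβ₁,
    integral_score_sq_mul_normalPDF_rpow θ₀ hσ hβ₂]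
  have hc : 0 < √(2 * π) * σ := by positivity
  have hpow : ((√(2 * π) * σ)⁻¹ ^ (1 + β)) ^ 2 =
      (√(2 * π) * σ)⁻¹ ^ (1 + 2 * β) * (√2 * √π * σ)⁻¹ := by
    rw [← rpow_natCast, ← rpow_mul (by positivity), ← sqrt_mul two_pos.le,
      ← rpow_add_one (by positivity)]
    congr 1
    push_cast
    ring
  have hcube : ((1 + β) ^ (3 / 2 : ℝ)) ^ 2 = (1 + β) ^ 3 := by
    rw [← rpow_natCast, ← rpow_mul hβ₁.le, ← rpow_natCast]
    norm_num
  have hpos : 0 < (√(2 * π) * σ)⁻¹ ^ (1 + 2 * β) := by positivity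
  rw [mul_pow, mul_pow, hpow, inv_pow, mul_pow σ, hcube]
  generalize (√(2 * π) * σ)⁻¹ ^ (1 + 2 * β) = d at hpos ⊢
  field_simp
  ring
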